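/- Define the operator Δ_g on smooth functions by Δ_g σ := Δ₁σ + (ν⁽¹⁾/4 − ν⁽²⁾/8 − ν⁽³⁾/16)·σ, and for a density ρ define Δσ := Δ_ρσ + ν_ρ·σ. Then for every density ρ and every smooth σ : U → ℝ one has Δ_g σ = √ρ·Δ(σ/√ρ) pointwise on U; in particular the conjugated operator σ ↦ √ρ·Δ(σ/√ρ) is independent of the density ρ. -/

import Mathlib

/-- The `A`-th partial derivative of a function `f : ℝⁿ → ℝ`. -/
noncomputable def pd {n : ℕ} (A : Fin n) (f : (Fin n → ℝ) → ℝ) (z : Fin n → ℝ) : ℝ :=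
  fderiv ℝ f z (Pi.single A 1)

/-- The Laplacian `Δ_ρ f := (1/ρ)·Σ_{A,B} ∂_A(ρ g^{AB} ∂_B f)`. -/
noncomputable def lap {n : ℕ} (ρ : (Fin n → ℝ) → ℝ) (g : (Fin n → ℝ) → Fin n → Fin n → ℝ)
    (f : (Fin n → ℝ) → ℝ) (z : Fin n → ℝ) : ℝ :=
  (ρ z)⁻¹ * ∑ A, ∑ B, pd A (fun w => ρ w * g w A B * pd B f w) z

/-- `ν⁽⁰⁾_ρ := (1/√ρ)·Δ₁(√ρ)`. -/
noncomputable def nuZero {n : ℕ} (ρ : (Fin n → ℝ) → ℝ) (g : (Fin n → ℝ) → Fin n → Fin n → ℝ)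
    (z : Fin n → ℝ) : ℝ :=
  (Real.sqrt (ρ z))⁻¹ * lap (fun _ => 1) g (fun w => Real.sqrt (ρ w)) z

/-- `ν⁽¹⁾ := Σ ∂_A∂_B g^{AB}`. -/
noncomputable def nuOne {n : ℕ} (g : (Fin n → ℝ) → Fin n → Fin n → ℝ) (z : Fin n → ℝ) : ℝ :=
  ∑ A, ∑ B, pd A (pd B (fun u => g u A B)) z

/-- `ν⁽²⁾ := Σ (∂_D g^{AB}) g_{BC} (∂_A g^{CD})`; `gl` denotes the lower-index inverse metric. -/
noncomputable def nuTwo {n : ℕ} (g gl : (Fin n → ℝ) → Fin n → Fin n → ℝ) (z : Fin n → ℝ) : ℝ :=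
  ∑ A, ∑ B, ∑ C, ∑ D,
    pd D (fun u => g u A B) z * gl z B C * pd A (fun u => g u C D) z

/-- `ν⁽³⁾ := Σ (∂_C g_{AB}) g^{CD} (∂_D g^{BA})`. -/
noncomputable def nuThree {n : ℕ} (g gl : (Fin n → ℝ) → Fin n → Fin n → ℝ) (z : Fin n → ℝ) : ℝ :=
  ∑ A, ∑ B, ∑ C, ∑ D,
    pd C (fun u => gl u A B) z * g z C D * pd D (fun u => gl u B A) z

/-- `ν_ρ := ν⁽⁰⁾_ρ + ν⁽¹⁾/4 − ν⁽²⁾/8 − ν⁽³⁾/16`. -/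
noncomputable def nuRho {n : ℕ} (ρ : (Fin n → ℝ) → ℝ) (g gl : (Fin n → ℝ) → Fin n → Fin n → ℝ)
    (z : Fin n → ℝ) : ℝ :=
  nuZero ρ g z + nuOne g z / 4 - nuTwo g gl z / 8 - nuThree g gl z / 16

lemma pd_congr {n : ℕ} {U : Set (Fin n → ℝ)} (hU : IsOpen U) {f h : (Fin n → ℝ) → ℝ}
    (hfh : ∀ w ∈ U, f w = h w) {z : Fin n → ℝ} (hz : z ∈ U) (A : Fin n) :
    pd A f z = pd A h z := by
  have : f =ᶠ[nhds z] h := by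
    filter_upwards [hU.mem_nhds hz] with w hw using hfh w hw
  simp only [pd, this.fderiv_eq]

lemma pd_mul {n : ℕ} {f h : (Fin n → ℝ) → ℝ} {z : Fin n → ℝ} (hf : DifferentiableAt ℝ f z)
    (hh : DifferentiableAt ℝ h z) (A : Fin n) :
    pd A (fun w => f w * h w) z = f z * pd A h z + h z * pd A f z := by
  simp [pd, fderiv_fun_mul hf hh]

lemma pd_sub {n : ℕ} {f h : (Fin n → ℝ) → ℝ} {z : Fin n → ℝ} (hf : DifferentiableAt ℝ f z)
    (hh : DifferentiableAt ℝ h z) (A : Fin n) :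
    pd A (fun w => f w - h w) z = pd A f z - pd A h z := by
  simp [pd, fderiv_fun_sub hf hh]

lemma ContDiffOn.differentiableAt_of_isOpen {n : ℕ} {U : Set (Fin n → ℝ)} (hU : IsOpen U)
    {f : (Fin n → ℝ) → ℝ} (hf : ContDiffOn ℝ (⊤ : ℕ∞) f U) {z : Fin n → ℝ} (hz : z ∈ U) :
    DifferentiableAt ℝ f z :=
  (hf.contDiffAt (hU.mem_nhds hz)).differentiableAt (by simp)

lemma ContDiffOn.pd {n : ℕ} {U : Set (Fin n → ℝ)} (hU : IsOpen U) {f : (Fin n → ℝ) → ℝ}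
    (hf : ContDiffOn ℝ (⊤ : ℕ∞) f U) (A : Fin n) : ContDiffOn ℝ (⊤ : ℕ∞) (pd A f) U :=
  (hf.fderiv_of_isOpen hU (by simp)).clm_apply contDiffOn_const

/-- `s² ∂_B(σ/s) = s ∂_B σ - σ ∂_B s` wherever `s ≠ 0`. -/
lemma sq_mul_pd_div {n : ℕ} {σ s : (Fin n → ℝ) → ℝ} {z : Fin n → ℝ}
    (hσ : DifferentiableAt ℝ σ z) (hs : DifferentiableAt ℝ s z) (hz : s z ≠ 0) (B : Fin n) :
    s z * s z * pd B (fun w => σ w / s w) z = s z * pd B σ z - σ z * pd B s z := by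
  have hd : DifferentiableAt ℝ (fun w => σ w / s w) z := by
    simpa only [div_eq_mul_inv] using hσ.fun_mul (hs.fun_inv hz)
  have hev : (fun w => σ w / s w * s w) =ᶠ[nhds z] σ := by
    filter_upwards [hs.continuousAt.eventually_ne hz] with w hw using div_mul_cancel₀ _ hw
  have h := pd_mul hd hs B
  have h' : pd B (fun w => σ w / s w * s w) z = pd B σ z := by
    simp only [pd, hev.fderiv_eq]
  rw [← h', h]
  field_simp
  ring

/-- The Laplacian of a quotient `σ / s` with respect to the density `s²`. -/
lemma lap_div_of_eq_sq {n : ℕ} {U : Set (Fin n → ℝ)} (hU : IsOpen U)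
    {g : (Fin n → ℝ) → Fin n → Fin n → ℝ}
    (hg : ∀ A B, ContDiffOn ℝ (⊤ : ℕ∞) (fun z => g z A B) U)
    (hgsymm : ∀ z ∈ U, ∀ A B, g z A B = g z B A)
    {ρ s σ : (Fin n → ℝ) → ℝ} (hρs : ∀ w ∈ U, ρ w = s w * s w) (hs0 : ∀ w ∈ U, s w ≠ 0)
    (hs : ContDiffOn ℝ (⊤ : ℕ∞) s U) (hσ : ContDiffOn ℝ (⊤ : ℕ∞) σ U)
    {z : Fin n → ℝ} (hz : z ∈ U) :
    lap ρ g (fun w => σ w / s w) z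
      = (s z * s z)⁻¹ * (s z * lap (fun _ => 1) g σ z - σ z * lap (fun _ => 1) g s z) := by
  have hd : ∀ {f : (Fin n → ℝ) → ℝ}, ContDiffOn ℝ (⊤ : ℕ∞) f U → DifferentiableAt ℝ f z :=
    fun hf => hf.differentiableAt_of_isOpen hU hz
  have key : ∀ A B, pd A (fun w => ρ w * g w A B * pd B (fun w => σ w / s w) w) z
      = s z * pd A (fun w => g w A B * pd B σ w) z - σ z * pd A (fun w => g w A B * pd B s w) z
        + (g z A B * pd A s z * pd B σ z - g z A B * pd B s z * pd A σ z) := by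
    intro A B
    have h1 := (hg A B).mul (hσ.pd hU B)
    have h2 := (hg A B).mul (hs.pd hU B)
    rw [pd_congr hU (h := fun w => s w * (g w A B * pd B σ w) - σ w * (g w A B * pd B s w)) _ hz,
      pd_sub (hd (hs.mul h1)) (hd (hσ.mul h2)), pd_mul (hd hs) (hd h1), pd_mul (hd hσ) (hd h2)]
    · ring
    · intro w hw
      have := sq_mul_pd_div (hσ.differentiableAt_of_isOpen hU hw)
        (hs.differentiableAt_of_isOpen hU hw) (hs0 w hw) B
      rw [hρs w hw]
      linear_combination g w A B * this
  have hswap : ∑ A, ∑ B, g z A B * pd B s z * pd A σ z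
      = ∑ A, ∑ B, g z A B * pd A s z * pd B σ z := by
    rw [Finset.sum_comm]
    exact Finset.sum_congr rfl fun A _ => Finset.sum_congr rfl fun B _ => by
      rw [hgsymm z hz B A]
  simp only [lap, key, hρs z hz, Finset.sum_add_distrib, Finset.sum_sub_distrib, hswap,
    ← Finset.mul_sum, one_mul, inv_one, sub_self, add_zero]

/-- with `Δ_g σ := Δ₁σ + (ν⁽¹⁾/4 − ν⁽²⁾/8 − ν⁽³⁾/16)·σ` and
`Δσ := Δ_ρσ + ν_ρ·σ`, for every density `ρ` and smooth `σ` one has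
`Δ_g σ = √ρ·Δ(σ/√ρ)` pointwise on `U`; in particular the conjugated operator
`σ ↦ √ρ·Δ(σ/√ρ)` is independent of the density `ρ`. -/
theorem stmt2 {n : ℕ} (U : Set (Fin n → ℝ)) (hU : IsOpen U)
    (g gl : (Fin n → ℝ) → Fin n → Fin n → ℝ)
    (hg : ∀ A B, ContDiffOn ℝ (⊤ : ℕ∞) (fun z => g z A B) U)
    (hgsymm : ∀ z ∈ U, ∀ A B, g z A B = g z B A)
    (hginv : ∀ z ∈ U, ∀ A C, ∑ B, gl z A B * g z B C = if A = C then 1 else 0)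
    (ρ : (Fin n → ℝ) → ℝ)
    (hρ : ContDiffOn ℝ (⊤ : ℕ∞) ρ U) (hρpos : ∀ z ∈ U, 0 < ρ z)
    (σ : (Fin n → ℝ) → ℝ) (hσ : ContDiffOn ℝ (⊤ : ℕ∞) σ U) :
    ∀ z ∈ U,
      lap (fun _ => 1) g σ z
          + (nuOne g z / 4 - nuTwo g gl z / 8 - nuThree g gl z / 16) * σ z
        = Real.sqrt (ρ z) *
          (lap ρ g (fun w => σ w / Real.sqrt (ρ w)) z
            + nuRho ρ g gl z * (σ z / Real.sqrt (ρ z))) := by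
  intro z hz
  have hs : ContDiffOn ℝ (⊤ : ℕ∞) (fun w => Real.sqrt (ρ w)) U :=
    hρ.sqrt fun w hw => (hρpos w hw).ne'
  have hs0 : ∀ w ∈ U, Real.sqrt (ρ w) ≠ 0 := fun w hw => (Real.sqrt_pos.2 (hρpos w hw)).ne'
  have hz0 := hs0 z hz
  rw [lap_div_of_eq_sq hU hg hgsymm (fun w hw => (Real.mul_self_sqrt (hρpos w hw).le).symm)
    hs0 hs hσ hz]
  unfold nuRho nuZero
  field_simp
  ring
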